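/- arXiv:0905.0092 — 3 statements merged into one kernel-verified Lean document; each statement's English description precedes it below -/
import Mathlib

section
/- Let H be a real Hilbert space, φ : H → ℝ a convex differentiable function whose gradient ∇φ is Lipschitz continuous on bounded sets, A : H → H a maximal monotone λ-cocoercive operator (λ > 0), γ > 0 with λγ² > 1, Θ : H → ℝ a differentiable convex function bounded below with ∇Θ δ-Lipschitz continuous and η-strongly monotone (δ, η > 0), and ε : [0,∞) → (0,∞) a C¹ decreasing function with ε(t) → 0 as t → +∞. Then for any solution u of ü(t) + γ u̇(t) + ∇φ(u(t)) + A(u(t)) + ε(t) ∇Θ(u(t)) = 0, both u and u̇ are bounded on [0,∞): sup_{t≥0} |u(t)| < ∞ and sup_{t≥0} |u̇(t)| < ∞. -/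
open Filter MeasureTheory Set Bornology
open scoped RealInnerProductSpace NNReal Topology

/-- The first-order (gradient) inequality for a differentiable convex function. -/
theorem ConvexOn.add_inner_gradient_le
    {H : Type*} [NormedAddCommGroup H] [InnerProductSpace ℝ H] [CompleteSpace H]
    {f : H → ℝ} {g x : H} (hf : ConvexOn ℝ univ f) (hg : HasGradientAt f g x) (y : H) :
    f x + ⟪g, y - x⟫ ≤ f y := by
  have hline : HasDerivAt (fun r : ℝ => x + r • (y - x)) (y - x) 0 := by
    simpa using ((hasDerivAt_id (0 : ℝ)).smul_const (y - x)).const_add x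
  have hg' : HasFDerivAt f (InnerProductSpace.toDual ℝ H g) (x + (0 : ℝ) • (y - x)) := by
    simpa using hg.hasFDerivAt
  have hder : HasDerivAt (fun r : ℝ => f (x + r • (y - x))) ⟪g, y - x⟫ 0 := by
    simpa [Function.comp_def] using hg'.comp_hasDerivAt (0 : ℝ) hline
  have hconv : ConvexOn ℝ univ (fun r : ℝ => f (x + r • (y - x))) := by
    have h := hf.comp_affineMap (AffineMap.lineMap x y : ℝ →ᵃ[ℝ] H)
    have e : (f ∘ (AffineMap.lineMap x y : ℝ →ᵃ[ℝ] H)) = fun r : ℝ => f (x + r • (y - x)) := by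
      ext r
      simp [AffineMap.lineMap_apply, add_comm]
    rw [e] at h
    simpa using h
  have h := hconv.le_slope_of_hasDerivAt (mem_univ 0) (mem_univ 1) one_pos hder
  simp only [slope_def_field, one_smul, zero_smul, add_zero, add_sub_cancel, sub_zero,
    div_one] at h
  linarith

/-- A function on `[0, ∞)` whose derivative is negative wherever it exceeds `K` is bounded
above. -/
theorem bddAbove_of_deriv_neg_of_lt {V W : ℝ → ℝ} {K : ℝ}
    (hV : ∀ t ∈ Ici (0 : ℝ), HasDerivWithinAt V (W t) (Ici 0) t)
    (hW : ∀ t ∈ Ici (0 : ℝ), K < V t → W t < 0) :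
    ∃ M : ℝ, ∀ t ∈ Ici (0 : ℝ), V t ≤ M := by
  refine ⟨max (V 0) (K + 1), fun t ht => ?_⟩
  refine image_le_of_deriv_right_lt_deriv_boundary (f' := W) (a := 0) (b := t)
    (B := fun _ => max (V 0) (K + 1)) (B' := fun _ => 0)
    (fun s hs => ((hV s hs.1).continuousWithinAt).mono Icc_subset_Ici_self)
    (fun s hs => (hV s hs.1).mono (Ici_subset_Ici.2 hs.1)) (le_max_left _ _)
    (fun s => hasDerivAt_const s _) (fun s hs h => hW s hs.1 ?_) ⟨ht, le_rfl⟩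
  rw [h]
  exact (lt_add_one K).trans_le (le_max_right _ _)

/-- Real-variable form of the dissipation estimate: if the Lyapunov function `V` is large, then
its derivative `W` is negative. Here `x, y, z` stand for `‖u'‖`, `‖u - p‖`, `‖A u - A p‖`, and
`e ≤ e₀` for the Tikhonov parameter. -/
theorem lyapunov_deriv_neg {lam γ η e e₀ K x y z ψ T P V W : ℝ} (hlam : 0 < lam) (hγ : 0 < γ)
    (hcond : 1 < lam * γ ^ 2) (hη : 0 < η) (he : 0 < e) (hee : e ≤ e₀)
    (hψ : 0 ≤ ψ) (hT : 0 ≤ T) (hP : T / 2 + η / 4 * y ^ 2 - K ≤ P)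
    (hVle : V ≤ 2 * lam * γ * (x ^ 2 / 2 + ψ + e * T) + x * y + γ / 2 * y ^ 2)
    (hWle : W ≤ 2 * lam * γ * (-γ * x ^ 2 + x * z) + x ^ 2 - ψ - lam * z ^ 2 - e * P)
    (hVK : ((lam * γ + 1) * (e₀ / (lam * γ ^ 2 - 1)) + 2 * lam * γ * e₀ + 4 * lam * γ * e₀
      + (γ / 2 + 1) * (4 / η)) * K < V) : W < 0 := by
  set κ := lam * γ ^ 2 - 1 with hκ
  have hκ0 : 0 < κ := by linarith
  have he₀ : 0 < e₀ := he.trans_le hee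
  set Q := κ / e₀ * x ^ 2 + ψ / e₀ + T / 2 + η / 4 * y ^ 2 with hQ
  have q1 : 0 ≤ κ / e₀ * x ^ 2 := by positivity
  have q2 : 0 ≤ ψ / e₀ := by positivity
  have q3 : 0 ≤ T / 2 := by positivity
  have q4 : 0 ≤ η / 4 * y ^ 2 := by positivity
  set R := (lam * γ + 1) * (e₀ / κ) + 2 * lam * γ * e₀ + 4 * lam * γ * e₀
      + (γ / 2 + 1) * (4 / η) with hR
  have hR0 : 0 < R := by positivity
  have hVR : V ≤ R * Q := by
    have h1 : (lam * γ + 1) * x ^ 2 ≤ (lam * γ + 1) * (e₀ / κ) * Q := by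
      calc (lam * γ + 1) * x ^ 2 = (lam * γ + 1) * (e₀ / κ) * (κ / e₀ * x ^ 2) := by field_simp
        _ ≤ _ := by gcongr; linarith
    have h2 : 2 * lam * γ * ψ ≤ 2 * lam * γ * e₀ * Q := by
      calc 2 * lam * γ * ψ = 2 * lam * γ * e₀ * (ψ / e₀) := by field_simp
        _ ≤ _ := by gcongr; linarith
    have h3 : 2 * lam * γ * (e * T) ≤ 4 * lam * γ * e₀ * Q := by
      calc 2 * lam * γ * (e * T) ≤ 2 * lam * γ * (e₀ * T) := by gcongr
        _ = 4 * lam * γ * e₀ * (T / 2) := by ring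
        _ ≤ _ := by gcongr; linarith
    have h4 : (γ / 2 + 1) * y ^ 2 ≤ (γ / 2 + 1) * (4 / η) * Q := by
      calc (γ / 2 + 1) * y ^ 2 = (γ / 2 + 1) * (4 / η) * (η / 4 * y ^ 2) := by field_simp
        _ ≤ _ := by gcongr; linarith
    have h5 : x * y ≤ x ^ 2 + y ^ 2 := by linarith [two_mul_le_add_sq x y, sq_nonneg x, sq_nonneg y]
    rw [hR]
    linarith
  have hKQ : K < Q := lt_of_mul_lt_mul_left (hVK.trans_le hVR) hR0.le
  have hz : 0 ≤ lam * (γ * x - z) ^ 2 := by positivity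
  have hW1 : W ≤ -(κ * x ^ 2) - ψ - e * P := by
    rw [hκ]
    linarith
  have hx : e * (κ / e₀ * x ^ 2) ≤ κ * x ^ 2 := by
    calc e * (κ / e₀ * x ^ 2) ≤ e₀ * (κ / e₀ * x ^ 2) := by gcongr
      _ = κ * x ^ 2 := by field_simp
  have hψe : e * (ψ / e₀) ≤ ψ := by
    calc e * (ψ / e₀) ≤ e₀ * (ψ / e₀) := by gcongr
      _ = ψ := by field_simp
  have heP := mul_le_mul_of_nonneg_left hP he.le
  have heQ := mul_lt_mul_of_pos_left hKQ he
  rw [hQ] at heQ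
  linarith

/-- Coercivity of the quadratic part of the Lyapunov function. -/
theorem lyapunov_coercive {lam γ x y : ℝ} (hγ : 0 < γ) (hcond : 1 < lam * γ ^ 2) :
    x ^ 2 / (2 * γ) ≤ lam * γ * x ^ 2 - x * y + γ / 2 * y ^ 2 ∧
      γ / 4 * y ^ 2 ≤ lam * γ * x ^ 2 - x * y + γ / 2 * y ^ 2 := by
  have h : x ^ 2 / γ ≤ lam * γ * x ^ 2 := by
    rw [div_le_iff₀ hγ]
    nlinarith [sq_nonneg x]
  have h1 : 0 ≤ (x - γ * y) ^ 2 / (2 * γ) := by positivity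
  have h2 : 0 ≤ (x - γ * y / 2) ^ 2 / γ := by positivity
  have e1 : (x - γ * y) ^ 2 / (2 * γ) = x ^ 2 / γ - x ^ 2 / (2 * γ) - x * y + γ / 2 * y ^ 2 := by
    field_simp
    ring
  have e2 : (x - γ * y / 2) ^ 2 / γ = x ^ 2 / γ - x * y + γ / 4 * y ^ 2 := by
    field_simp
    ring
  constructor <;> linarith

/-- For the Tikhonov-regularized dynamic
`ü + γu̇ + ∇φ(u) + A(u) + ε(t)∇Θ(u) = 0` with `λγ² > 1` and `ε` decreasing to `0`, every
solution has bounded trajectory and bounded velocity. -/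
theorem tikhonov_dynamic_bounded_trajectories
    {H : Type*} [NormedAddCommGroup H] [InnerProductSpace ℝ H] [CompleteSpace H]
    (φ : H → ℝ) (φ' : H → H) (A : H → H) (lam γ : ℝ)
    (Θ : H → ℝ) (Θ' : H → H) (δ η : ℝ) (ε : ℝ → ℝ)
    (hφconv : ConvexOn ℝ univ φ)
    (hφgrad : ∀ x, HasGradientAt φ (φ' x) x)
    (hφlip : ∀ s : Set H, IsBounded s → ∃ K : ℝ≥0, LipschitzOnWith K φ' s)
    (hAmono : ∀ v w : H, 0 ≤ ⟪A v - A w, v - w⟫)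
    (hAmax : ∀ x y : H, (∀ v : H, 0 ≤ ⟪A v - y, v - x⟫) → y = A x)
    (hlam : 0 < lam)
    (hAcoco : ∀ v w : H, lam * ‖A v - A w‖ ^ 2 ≤ ⟪A v - A w, v - w⟫)
    (hγ : 0 < γ) (hcond : 1 < lam * γ ^ 2)
    (hΘconv : ConvexOn ℝ univ Θ) (hΘbdd : BddBelow (range Θ))
    (hΘgrad : ∀ x, HasGradientAt Θ (Θ' x) x)
    (hδ : 0 < δ) (hΘlip : ∀ x y : H, ‖Θ' x - Θ' y‖ ≤ δ * ‖x - y‖)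
    (hη : 0 < η) (hΘsm : ∀ x y : H, η * ‖x - y‖ ^ 2 ≤ ⟪Θ' x - Θ' y, x - y⟫)
    (hεC1 : ContDiffOn ℝ 1 ε (Ici 0)) (hεpos : ∀ t ∈ Ici (0:ℝ), 0 < ε t)
    (hεdec : AntitoneOn ε (Ici 0)) (hεlim : Tendsto ε atTop (𝓝 0))
    (S : Set H) (hS : S = {v : H | φ' v + A v = 0}) (hSne : S.Nonempty)
    (u u' u'' : ℝ → H)
    (hu : ∀ t ∈ Ici (0:ℝ), HasDerivWithinAt u (u' t) (Ici 0) t)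
    (hu' : ∀ t ∈ Ici (0:ℝ), HasDerivWithinAt u' (u'' t) (Ici 0) t)
    (hu''cont : ContinuousOn u'' (Ici 0))
    (heq : ∀ t ∈ Ici (0:ℝ), u'' t + γ • u' t + φ' (u t) + A (u t) + ε t • Θ' (u t) = 0)
    :
    (∃ M : ℝ, ∀ t ∈ Ici (0:ℝ), ‖u t‖ ≤ M) ∧ (∃ M : ℝ, ∀ t ∈ Ici (0:ℝ), ‖u' t‖ ≤ M) := by
  obtain ⟨p, hp⟩ := hSne
  rw [hS, mem_ofPred_eq] at hp
  obtain ⟨m, hm⟩ := hΘbdd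
  have hm' : ∀ x, m ≤ Θ x := fun x => hm (mem_range_self x)
  have hεdiff : ∀ t ∈ Ici (0 : ℝ), HasDerivWithinAt ε (derivWithin ε (Ici 0) t) (Ici 0) t :=
    fun t ht => (hεC1.differentiableOn one_ne_zero t ht).hasDerivWithinAt
  have hψ : ∀ x, 0 ≤ φ x - φ p - ⟪φ' p, x - p⟫ := fun x => by
    linarith [hφconv.add_inner_gradient_le (hφgrad p) x]
  let V : ℝ → ℝ := fun t => 2 * lam * γ * (⟪u' t, u' t⟫ / 2 +
    (φ (u t) - φ p - ⟪φ' p, u t - p⟫) + ε t * (Θ (u t) - m)) + ⟪u' t, u t - p⟫ +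
    γ / 2 * ⟪u t - p, u t - p⟫
  let W : ℝ → ℝ := fun t => 2 * lam * γ * ((⟪u' t, u'' t⟫ + ⟪u'' t, u' t⟫) / 2 +
    (⟪φ' (u t), u' t⟫ - ⟪φ' p, u' t⟫) +
    (derivWithin ε (Ici 0) t * (Θ (u t) - m) + ε t * ⟪Θ' (u t), u' t⟫)) +
    (⟪u' t, u' t⟫ + ⟪u'' t, u t - p⟫) + γ / 2 * (⟪u t - p, u' t⟫ + ⟪u' t, u t - p⟫)
  have hVder : ∀ t ∈ Ici (0 : ℝ), HasDerivWithinAt V (W t) (Ici 0) t := by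
    intro t ht
    have hup := (hu t ht).sub_const p
    have hφu : HasDerivWithinAt (fun s => φ (u s)) ⟪φ' (u t), u' t⟫ (Ici 0) t := by
      simpa [Function.comp_def] using (hφgrad (u t)).hasFDerivAt.comp_hasDerivWithinAt t (hu t ht)
    have hΘu : HasDerivWithinAt (fun s => Θ (u s)) ⟪Θ' (u t), u' t⟫ (Ici 0) t := by
      simpa [Function.comp_def] using (hΘgrad (u t)).hasFDerivAt.comp_hasDerivWithinAt t (hu t ht)
    have hpu : HasDerivWithinAt (fun s => ⟪φ' p, u s - p⟫) ⟪φ' p, u' t⟫ (Ici 0) t := by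
      simpa using (hasDerivWithinAt_const t (Ici 0) (φ' p)).inner ℝ hup
    exact (((((((hu' t ht).inner ℝ (hu' t ht)).div_const 2).add
      ((hφu.sub_const (φ p)).sub hpu)).add ((hεdiff t ht).mul (hΘu.sub_const m))).const_mul
      (2 * lam * γ)).add ((hu' t ht).inner ℝ hup)).add ((hup.inner ℝ hup).const_mul (γ / 2))
  obtain ⟨M, hM⟩ := bddAbove_of_deriv_neg_of_lt (K := ((lam * γ + 1) * (ε 0 / (lam * γ ^ 2 - 1)) +
      2 * lam * γ * ε 0 + 4 * lam * γ * ε 0 + (γ / 2 + 1) * (4 / η)) *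
      ((Θ p - m) / 2 + ‖Θ' p‖ ^ 2 / (4 * η))) hVder (by
    intro t ht hVK
    refine lyapunov_deriv_neg (x := ‖u' t‖) (y := ‖u t - p‖) (z := ‖A (u t) - A p‖)
      (ψ := φ (u t) - φ p - ⟪φ' p, u t - p⟫) (T := Θ (u t) - m)
      (P := ⟪Θ' (u t), u t - p⟫) hlam hγ hcond hη (hεpos t ht) (hεdec self_mem_Ici ht ht) (hψ _)
      (sub_nonneg.2 (hm' _)) ?_ ?_ ?_ hVK
    · have h1 := hΘconv.add_inner_gradient_le (hΘgrad (u t)) p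
      have h2 := hΘsm (u t) p
      have h3 := (abs_le.1 (abs_real_inner_le_norm (Θ' p) (u t - p))).1
      have h4 : 0 ≤ (η * ‖u t - p‖ - ‖Θ' p‖) ^ 2 / (4 * η) := by positivity
      have e4 : (η * ‖u t - p‖ - ‖Θ' p‖) ^ 2 / (4 * η) =
          η / 4 * ‖u t - p‖ ^ 2 - ‖Θ' p‖ * ‖u t - p‖ / 2 + ‖Θ' p‖ ^ 2 / (4 * η) := by
        field_simp
        ring
      rw [← neg_sub (u t) p, inner_neg_right] at h1
      rw [inner_sub_left] at h2
      linarith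
    · have h1 := real_inner_le_norm (u' t) (u t - p)
      simp only [V, real_inner_self_eq_norm_sq]
      linarith
    · have hu2 : u'' t = -(γ • u' t) - φ' (u t) - A (u t) - ε t • Θ' (u t) := by
        rw [← sub_eq_zero, ← heq t ht]
        abel
      have hφp : φ' p = -A p := eq_neg_of_add_eq_zero_left hp
      have hε' : derivWithin ε (Ici 0) t * (Θ (u t) - m) ≤ 0 :=
        mul_nonpos_of_nonpos_of_nonneg hεdec.derivWithin_nonpos (sub_nonneg.2 (hm' _))
      have hA1 := (abs_le.1 (abs_real_inner_le_norm (A (u t) - A p) (u' t))).1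
      have hA2 := hAcoco (u t) p
      have hφ1 := hφconv.add_inner_gradient_le (hφgrad (u t)) p
      have hscale : 2 * lam * γ * (derivWithin ε (Ici 0) t * (Θ (u t) - m) -
          ⟪A (u t) - A p, u' t⟫ - ‖A (u t) - A p‖ * ‖u' t‖) ≤ 0 :=
        mul_nonpos_of_nonneg_of_nonpos (by positivity) (by linarith)
      rw [← neg_sub (u t) p, inner_neg_right] at hφ1
      rw [inner_sub_left] at hA2 hscale
      simp only [W]
      rw [real_inner_comm (u'' t) (u' t), real_inner_comm (u' t) (u t - p), hu2, hφp]
      simp only [inner_sub_left, inner_neg_left, real_inner_smul_left, real_inner_self_eq_norm_sq]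
      linarith)
  have hcoer : ∀ t ∈ Ici (0 : ℝ), ‖u' t‖ ^ 2 / (2 * γ) ≤ M ∧ γ / 4 * ‖u t - p‖ ^ 2 ≤ M := by
    intro t ht
    have hVt : lam * γ * ‖u' t‖ ^ 2 - ‖u' t‖ * ‖u t - p‖ + γ / 2 * ‖u t - p‖ ^ 2 ≤ M := by
      refine le_trans ?_ (hM t ht)
      have h1 := (abs_le.1 (abs_real_inner_le_norm (u' t) (u t - p))).1
      have h2 := hψ (u t)
      have h3 : 0 ≤ ε t * (Θ (u t) - m) := mul_nonneg (hεpos t ht).le (sub_nonneg.2 (hm' _))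
      have h4 : 0 ≤ 2 * lam * γ *
          ((φ (u t) - φ p - ⟪φ' p, u t - p⟫) + ε t * (Θ (u t) - m)) := by positivity
      simp only [V, real_inner_self_eq_norm_sq]
      linarith
    have h := lyapunov_coercive (x := ‖u' t‖) (y := ‖u t - p‖) hγ hcond
    exact ⟨h.1.trans hVt, h.2.trans hVt⟩
  refine ⟨⟨√(M / (γ / 4)) + ‖p‖, fun t ht => ?_⟩, ⟨√(M * (2 * γ)), fun t ht => ?_⟩⟩
  · have h : ‖u t - p‖ ≤ √(M / (γ / 4)) := by
      refine Real.le_sqrt_of_sq_le ?_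
      rw [le_div_iff₀ (by positivity), mul_comm]
      exact (hcoer t ht).2
    linarith [norm_le_norm_sub_add (u t) p]
  · refine Real.le_sqrt_of_sq_le ?_
    rw [← div_le_iff₀ (by positivity)]
    exact (hcoer t ht).1
end

section
/- Let H be a real Hilbert space, φ : H → ℝ a convex differentiable function whose gradient ∇φ is Lipschitz continuous on bounded sets, A : H → H a maximal monotone λ-cocoercive operator (λ > 0), γ > 0 with λγ² > 1, Θ : H → ℝ a differentiable convex function bounded below with ∇Θ δ-Lipschitz continuous and η-strongly monotone (δ, η > 0), and ε : [0,∞) → (0,∞) a C¹ decreasing function with ε(t) → 0 as t → +∞ and ∫₀^∞ ε(s) ds = ∞. Suppose S := (∇φ + A)⁻¹(0) is nonempty and let u_* be the unique element of S satisfying ⟨∇Θ(u_*), v − u_*⟩ ≥ 0 for all v ∈ S. Let u be a solution of ü(t) + γ u̇(t) + ∇φ(u(t)) + A(u(t)) + ε(t) ∇Θ(u(t)) = 0. Then the following are equivalent: (i1) every weak cluster point of u(t) as t → +∞ belongs to S; (i2) liminf_{t→+∞} ⟨∇Θ(u_*), u(t) − u_*⟩ ≥ 0; (i3) u(t) → u_*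 strongly as t → +∞. -/
open Filter MeasureTheory Set Bornology
open scoped RealInnerProductSpace NNReal Topology ENNReal

theorem ConvexOn.inner_gradient_le_sub {H : Type*} [NormedAddCommGroup H]
    [InnerProductSpace ℝ H] [CompleteSpace H] {φ : H → ℝ} (hφ : ConvexOn ℝ univ φ) {g x : H}
    (hg : HasGradientAt φ g x) (y : H) : ⟪g, y - x⟫ ≤ φ y - φ x := by
  have hline : ConvexOn ℝ univ (fun s : ℝ => φ (AffineMap.lineMap x y s)) := by
    exact hφ.comp_affineMap (AffineMap.lineMap x y : ℝ →ᵃ[ℝ] H)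
  have hderiv : HasDerivAt (fun s : ℝ => φ (AffineMap.lineMap x y s)) ⟪g, y - x⟫ 0 := by
    have hg' : HasFDerivAt φ (InnerProductSpace.toDual ℝ H g) (AffineMap.lineMap x y (0 : ℝ)) := by
      simpa using hg.hasFDerivAt
    exact hg'.comp_hasDerivAt (0 : ℝ) AffineMap.hasDerivAt_lineMap
  simpa [slope_def_field] using
    hline.le_slope_of_hasDerivAt (mem_univ 0) (mem_univ 1) zero_lt_one hderiv

theorem exists_subseq_weakly_tendsto {H : Type*} [NormedAddCommGroup H]
    [InnerProductSpace ℝ H] [CompleteSpace H] {x : ℕ → H} {R : ℝ} (hx : ∀ n, ‖x n‖ ≤ R) :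
    ∃ (z : H) (k : ℕ → ℕ), StrictMono k ∧
      ∀ f : H →L[ℝ] ℝ, Tendsto (fun n => f (x (k n))) atTop (𝓝 (f z)) := by
  let V : Submodule ℝ H := (Submodule.span ℝ (range x)).topologicalClosure
  have hVsep : TopologicalSpace.SeparableSpace V := by
    have : TopologicalSpace.IsSeparable (V : Set H) := by
      rw [Submodule.topologicalClosure_coe]
      exact ((countable_range x).isSeparable.span (R := ℝ)).closure
    exact this.separableSpace
  have hVcomplete : CompleteSpace V :=
    (Submodule.isClosed_topologicalClosure _).completeSpace_coe
  have hxV : ∀ n, x n ∈ V := fun n =>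
    Submodule.le_topologicalClosure _ (Submodule.subset_span (mem_range_self n))
  let y : ℕ → WeakDual ℝ V := fun n =>
    StrongDual.toWeakDual (InnerProductSpace.toDual ℝ V ⟨x n, hxV n⟩)
  have hy : ∀ n, y n ∈ WeakDual.toStrongDual ⁻¹' Metric.closedBall (0 : StrongDual ℝ V) R := by
    intro n
    refine mem_closedBall_zero_iff.mpr (?_ : ‖InnerProductSpace.toDual ℝ V ⟨x n, hxV n⟩‖ ≤ R)
    simpa using hx n
  obtain ⟨L, -, k, hk, hL⟩ := WeakDual.isSeqCompact_closedBall ℝ V 0 R hy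
  refine ⟨((InnerProductSpace.toDual ℝ V).symm (WeakDual.toStrongDual L) : V), k, hk, fun f => ?_⟩
  let c : V := (InnerProductSpace.toDual ℝ V).symm (f.comp V.subtypeL)
  have hc : ∀ v : V, f v = ⟪v, c⟫ := fun v => by
    rw [real_inner_comm]
    simp [c]
  have hLc := (WeakDual.eval_continuous c).continuousAt.tendsto.comp hL
  rw [hc]
  simp only [InnerProductSpace.toDual_symm_apply]
  refine hLc.congr fun n => ?_
  exact (hc ⟨x (k n), hxV (k n)⟩).symm

theorem gronwall_of_divergent_rate {ε F F' : ℝ → ℝ} {T κ τ : ℝ} (hT : 0 ≤ T) (hκ : 0 < κ)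
    (hε : ContinuousOn ε (Ici 0)) (hεpos : ∀ t ∈ Ici (0 : ℝ), 0 < ε t)
    (hεdiv : (∫⁻ t in Ici (0:ℝ), ENNReal.ofReal (ε t)) = ∞)
    (hF : ∀ t ∈ Ici (0:ℝ), HasDerivWithinAt F (F' t) (Ici 0) t)
    (hFle : ∀ t ≥ T, F' t + κ * ε t * F t ≤ τ * ε t) :
    ∀ σ > τ / κ, ∀ᶠ t in atTop, F t ≤ σ := by
  set e : ℝ → ℝ := fun t => ε (max t 0)
  have he : Continuous e :=
    hε.comp_continuous (by fun_prop) fun t => le_max_right t 0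
  have hepos : ∀ t, 0 < e t := fun t => hεpos _ (le_max_right t 0)
  have heq : ∀ t, 0 ≤ t → e t = ε t := fun t ht => by simp [e, ht]
  set I : ℝ → ℝ := fun t => ∫ s in (0 : ℝ)..t, e s
  have hI : ∀ t, HasDerivAt I (e t) t := fun t => he.integral_hasStrictDerivAt 0 t |>.hasDerivAt
  have hImono : Monotone I := monotone_of_hasDerivAt_nonneg hI fun t => (hepos t).le
  have hItop : Tendsto I atTop atTop := by
    refine tendsto_atTop_atTop_of_monotone hImono fun M => ?_
    by_contra! hM
    have hint : IntegrableOn e (Ioi 0) :=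
      integrableOn_Ioi_of_intervalIntegral_norm_bounded (l := atTop) (b := id) M 0
        (fun t => (he.integrableOn_Icc.mono_set Ioc_subset_Icc_self)) tendsto_id
        (Eventually.of_forall fun t => by
          simpa [I, abs_of_pos (hepos _)] using (hM t).le)
    have hlt : ∫⁻ t in Ici (0:ℝ), ENNReal.ofReal (ε t) < ∞ := by
      have := (hint.congr_set_ae Ioi_ae_eq_Ici.symm).lintegral_lt_top
      rwa [setLIntegral_congr_fun measurableSet_Ici
        (fun t ht => by rw [heq t ht])] at this
    exact hlt.ne hεdiv
  set P : ℝ → ℝ := fun t => Real.exp (κ * I t) * (F t - τ / κ)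
  have hP : ∀ t ∈ Ici (0:ℝ), HasDerivWithinAt P
      (Real.exp (κ * I t) * (κ * e t) * (F t - τ / κ) + Real.exp (κ * I t) * F' t) (Ici 0) t :=
    fun t ht => (((hI t).const_mul κ).exp.hasDerivWithinAt).mul ((hF t ht).sub_const _)
  have hsub : Ici T ⊆ Ici (0 : ℝ) := Ici_subset_Ici.mpr hT
  have hanti : AntitoneOn P (Ici T) := by
    refine antitoneOn_of_hasDerivWithinAt_nonpos (convex_Ici T)
      (fun t ht => ((hP t (hsub ht)).continuousWithinAt).mono hsub)
      (fun t ht => (hP t (hsub (interior_subset ht))).mono (interior_subset.trans hsub)) ?_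
    intro t ht
    have htT : t ∈ Ici T := interior_subset ht
    have h1 := hFle t htT
    rw [heq t (hsub htT)]
    have h2 : Real.exp (κ * I t) * (κ * ε t) * (F t - τ / κ) + Real.exp (κ * I t) * F' t
        = Real.exp (κ * I t) * (F' t + κ * ε t * F t - τ * ε t) := by
      field_simp
      ring
    rw [h2]
    exact mul_nonpos_of_nonneg_of_nonpos (Real.exp_pos _).le (by linarith)
  intro σ hσ
  have hlim : Tendsto (fun t => Real.exp (κ * I t) * (σ - τ / κ)) atTop atTop :=
    (Real.tendsto_exp_atTop.comp (hItop.const_mul_atTop hκ)).atTop_mul_const (sub_pos.mpr hσ)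
  filter_upwards [hlim.eventually_ge_atTop (P T), eventually_ge_atTop T] with t h1 h2
  have h3 : Real.exp (κ * I t) * (F t - τ / κ) ≤ Real.exp (κ * I t) * (σ - τ / κ) :=
    (hanti self_mem_Ici h2 h2).trans h1
  have := le_of_mul_le_mul_left h3 (Real.exp_pos _)
  linarith

theorem exists_energy_dissipation_rate {H : Type*} [NormedAddCommGroup H] [InnerProductSpace ℝ H]
    {lam γ δ η : ℝ} (hlam : 0 < lam) (hγ : 0 < γ) (hcond : 1 < lam * γ ^ 2) (hδ : 0 < δ)
    (hη : 0 < η) (g₀ : H) :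
    ∃ κ > 0, ∃ K : ℝ, ∃ e₀ > 0, ∀ (x v a q b g : H) (G e : ℝ), 0 ≤ G → G ≤ ⟪q, x⟫ →
      lam * ‖b‖ ^ 2 ≤ ⟪b, x⟫ → ‖g - g₀‖ ≤ δ * ‖x‖ → η * ‖x‖ ^ 2 ≤ ⟪g - g₀, x⟫ →
      0 < e → e ≤ e₀ → a + γ • v + q + b + e • g = 0 →
      2 * lam * γ * (⟪a, v⟫ + ⟪q, v⟫) + (⟪a, x⟫ + ⟪v, v⟫) + γ * ⟪v, x⟫
        + κ * e * (2 * lam * γ * (1 / 2 * ‖v‖ ^ 2 + G) + ⟪v, x⟫ + γ / 2 * ‖x‖ ^ 2)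
        ≤ (K * e - ⟪g₀, x⟫ - η / 4 * ‖x‖ ^ 2) * e := by
  set α := 2 * lam * γ with hα
  set c := lam * γ ^ 2 - 1 with hc
  have hαpos : 0 < α := by positivity
  have hcpos : 0 < c := by linarith
  set w := ‖g₀‖
  set K := α ^ 2 / c * (w ^ 2 + δ ^ 2) with hK
  have hKpos : 0 < K := by positivity
  set C := α + 1 + γ with hC
  have hCpos : 0 < C := by positivity
  set m := min (c / 2) (min 1 (η / 2)) with hm
  have hmpos : 0 < m := by positivity
  have hm1 : m ≤ c / 2 := min_le_left _ _
  have hm2 : m ≤ 1 := (min_le_right _ _).trans (min_le_left _ _)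
  have hm3 : m ≤ η / 2 := (min_le_right _ _).trans (min_le_right _ _)
  refine ⟨m / C, by positivity, K, min 1 (η / 4 / K), by positivity, ?_⟩
  intro x v a q b g G e hG hGq hb hlip hsm he he₀ heq
  have he1 : e ≤ 1 := he₀.trans (min_le_left _ _)
  have he2 : K * e ≤ η / 4 := by
    have := he₀.trans (min_le_right _ _)
    rwa [le_div_iff₀ hKpos, mul_comm] at this
  have ha : a = -(γ • v + q + b + e • g) := by
    rw [eq_neg_iff_add_eq_zero, ← heq]; abel
  have hav : ⟪a, v⟫ = -(γ * ‖v‖ ^ 2 + ⟪q, v⟫ + ⟪b, v⟫ + e * ⟪g, v⟫) := by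
    rw [ha]; simp only [inner_neg_left, inner_add_left, real_inner_smul_left,
      real_inner_self_eq_norm_sq]
  have hax : ⟪a, x⟫ = -(γ * ⟪v, x⟫ + ⟪q, x⟫ + ⟪b, x⟫ + e * ⟪g, x⟫) := by
    rw [ha]; simp only [inner_neg_left, inner_add_left, real_inner_smul_left]
  have hgx : η * ‖x‖ ^ 2 + ⟪g₀, x⟫ ≤ ⟪g, x⟫ := by
    rw [inner_sub_left] at hsm; linarith
  have hg : ‖g‖ ≤ w + δ * ‖x‖ := by
    have := norm_add_le (g - g₀) g₀
    rw [sub_add_cancel] at this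
    linarith
  have hbv : -(‖b‖ * ‖v‖) ≤ ⟪b, v⟫ := neg_le_of_abs_le (abs_real_inner_le_norm b v)
  have hgv : -(‖g‖ * ‖v‖) ≤ ⟪g, v⟫ := neg_le_of_abs_le (abs_real_inner_le_norm g v)
  have hvx : ⟪v, x⟫ ≤ ‖v‖ * ‖x‖ := real_inner_le_norm v x
  rw [hav, hax, real_inner_self_eq_norm_sq]
  have hcross : α * (‖b‖ * ‖v‖) ≤ lam * ‖b‖ ^ 2 + lam * γ ^ 2 * ‖v‖ ^ 2 := by
    have : 0 ≤ lam * (‖b‖ - γ * ‖v‖) ^ 2 := by positivity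
    rw [hα]; nlinarith
  have hgcross : α * e * (‖g‖ * ‖v‖) ≤ c / 2 * ‖v‖ ^ 2 + K * e ^ 2 * (1 + ‖x‖ ^ 2) := by
    have h1 : α * e * (‖g‖ * ‖v‖) ≤ c / 2 * ‖v‖ ^ 2 + α ^ 2 / (2 * c) * e ^ 2 * ‖g‖ ^ 2 := by
      have h : 0 ≤ (c * ‖v‖ - α * e * ‖g‖) ^ 2 / (2 * c) := by positivity
      have h' : (c * ‖v‖ - α * e * ‖g‖) ^ 2 / (2 * c)
        = c / 2 * ‖v‖ ^ 2 + α ^ 2 / (2 * c) * e ^ 2 * ‖g‖ ^ 2 - α * e * (‖g‖ * ‖v‖) := by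
        field_simp
        ring
      linarith
    have h2 : ‖g‖ ^ 2 ≤ 2 * ((w ^ 2 + δ ^ 2) * (1 + ‖x‖ ^ 2)) := by
      have h3 : ‖g‖ ^ 2 ≤ (w + δ * ‖x‖) ^ 2 := by gcongr
      have h4 : 0 ≤ (w ^ 2 + δ ^ 2) * (1 + ‖x‖ ^ 2) := by positivity
      have h5 : 0 ≤ (w * ‖x‖ - δ) ^ 2 := sq_nonneg _
      linarith
    have h3 : α ^ 2 / (2 * c) * e ^ 2 * ‖g‖ ^ 2
        ≤ α ^ 2 / (2 * c) * e ^ 2 * (2 * ((w ^ 2 + δ ^ 2) * (1 + ‖x‖ ^ 2))) := by gcongr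
    have h4 : α ^ 2 / (2 * c) * e ^ 2 * (2 * ((w ^ 2 + δ ^ 2) * (1 + ‖x‖ ^ 2)))
        = K * e ^ 2 * (1 + ‖x‖ ^ 2) := by
      rw [hK]; field_simp
    linarith
  have henergy : α * (1 / 2 * ‖v‖ ^ 2 + G) + ⟪v, x⟫ + γ / 2 * ‖x‖ ^ 2
      ≤ C * (‖v‖ ^ 2 + G + ‖x‖ ^ 2) := by
    have h1 : 0 ≤ α * (1 / 2 * ‖v‖ ^ 2 + ‖x‖ ^ 2) := by positivity
    have h2 : 0 ≤ γ * (‖v‖ ^ 2 + G + 1 / 2 * ‖x‖ ^ 2) := by positivity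
    have h3 : 0 ≤ (‖v‖ - ‖x‖) ^ 2 + ‖v‖ ^ 2 + ‖x‖ ^ 2 := by positivity
    rw [hC]
    linarith
  have hdecay : m / C * e * (α * (1 / 2 * ‖v‖ ^ 2 + G) + ⟪v, x⟫ + γ / 2 * ‖x‖ ^ 2)
      ≤ c / 2 * ‖v‖ ^ 2 + G + η / 2 * e * ‖x‖ ^ 2 := by
    have h1 : m / C * e * (α * (1 / 2 * ‖v‖ ^ 2 + G) + ⟪v, x⟫ + γ / 2 * ‖x‖ ^ 2)
        ≤ m / C * e * (C * (‖v‖ ^ 2 + G + ‖x‖ ^ 2)) := by gcongr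
    have h2 : m / C * e * (C * (‖v‖ ^ 2 + G + ‖x‖ ^ 2))
        = m * e * ‖v‖ ^ 2 + m * e * G + m * e * ‖x‖ ^ 2 := by
      field_simp
    have h3 : m * e ≤ c / 2 := (mul_le_of_le_one_right hmpos.le he1).trans hm1
    have h4 : m * e ≤ 1 := (mul_le_of_le_one_right hmpos.le he1).trans hm2
    have h5 : m * e ≤ η / 2 * e := by gcongr
    have h6 : m * e * ‖v‖ ^ 2 ≤ c / 2 * ‖v‖ ^ 2 := by gcongr
    have h7 : m * e * G ≤ 1 * G := by gcongr
    have h8 : m * e * ‖x‖ ^ 2 ≤ η / 2 * e * ‖x‖ ^ 2 := by gcongr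
    linarith
  have hb' : α * -⟪b, v⟫ ≤ α * (‖b‖ * ‖v‖) := by gcongr; linarith
  have hg' : α * e * -⟪g, v⟫ ≤ α * e * (‖g‖ * ‖v‖) := by gcongr; linarith
  have hgx' : e * (η * ‖x‖ ^ 2 + ⟪g₀, x⟫) ≤ e * ⟪g, x⟫ := by gcongr
  have hKe : K * e * (e * ‖x‖ ^ 2) ≤ η / 4 * (e * ‖x‖ ^ 2) := by gcongr
  have hαγ : α * γ * ‖v‖ ^ 2 = 2 * (lam * γ ^ 2) * ‖v‖ ^ 2 := by rw [hα]; ring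
  have hcv : c * ‖v‖ ^ 2 = lam * γ ^ 2 * ‖v‖ ^ 2 - ‖v‖ ^ 2 := by rw [hc]; ring
  linarith

theorem hasDerivWithinAt_energy {H : Type*} [NormedAddCommGroup H] [InnerProductSpace ℝ H]
    [CompleteSpace H] {φ : H → ℝ} {φ' : H → H} (hφgrad : ∀ x, HasGradientAt φ (φ' x) x)
    (α γ : ℝ) (p : H) {u u' : ℝ → H} {u'' : H} {s : Set ℝ} {t : ℝ}
    (hu : HasDerivWithinAt u (u' t) s t) (hu' : HasDerivWithinAt u' u'' s t) :
    HasDerivWithinAt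
      (fun t => α * (1 / 2 * ‖u' t‖ ^ 2 + (φ (u t) - φ p - ⟪φ' p, u t - p⟫)) + ⟪u' t, u t - p⟫
        + γ / 2 * ‖u t - p‖ ^ 2)
      (α * (⟪u'', u' t⟫ + ⟪φ' (u t) - φ' p, u' t⟫) + (⟪u'', u t - p⟫ + ⟪u' t, u' t⟫)
        + γ * ⟪u' t, u t - p⟫) s t := by
  have hx := hu.sub_const p
  have hφ : HasDerivWithinAt (fun t => φ (u t)) ⟪φ' (u t), u' t⟫ s t := by
    have := (hφgrad (u t)).hasFDerivAt.comp_hasDerivWithinAt t hu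
    exact this
  have hlin : HasDerivWithinAt (fun t => ⟪φ' p, u t - p⟫) ⟪φ' p, u' t⟫ s t := by
    simpa using (hasDerivWithinAt_const t s (φ' p)).inner ℝ hx
  refine (((((hu'.norm_sq.const_mul (1 / 2)).add ((hφ.sub_const (φ p)).sub hlin)).const_mul α).add
    (hu'.inner ℝ hx)).add (hx.norm_sq.const_mul (γ / 2))).congr_deriv ?_
  rw [inner_sub_left (φ' (u t)), real_inner_comm (u' t) u'', real_inner_comm (u' t) (u t - p)]
  ring

theorem energy_lower_bound {H : Type*} [NormedAddCommGroup H] [InnerProductSpace ℝ H]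
    {α γ G : ℝ} (hα : 0 < α) (hG : 0 ≤ G) (v x : H) :
    (γ - 1 / α) / 2 * ‖x‖ ^ 2 ≤ α * (1 / 2 * ‖v‖ ^ 2 + G) + ⟪v, x⟫ + γ / 2 * ‖x‖ ^ 2 := by
  have hvx : -(‖v‖ * ‖x‖) ≤ ⟪v, x⟫ := neg_le_of_abs_le (abs_real_inner_le_norm v x)
  have hsq : 0 ≤ (α * ‖v‖ - ‖x‖) ^ 2 / (2 * α) := by positivity
  have hexp : (α * ‖v‖ - ‖x‖) ^ 2 / (2 * α)
      = α / 2 * ‖v‖ ^ 2 - ‖v‖ * ‖x‖ + 1 / α / 2 * ‖x‖ ^ 2 := by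
    field_simp
    ring
  have hαG : 0 ≤ α * G := by positivity
  linarith

/-- Trajectories of the Tikhonov-regularized dynamic are bounded, and they converge strongly to
`p` as soon as `⟪Θ' p, u t - p⟫` is asymptotically nonnegative. -/
theorem tikhonov_bounded_and_tendsto {H : Type*} [NormedAddCommGroup H] [InnerProductSpace ℝ H]
    [CompleteSpace H] {φ : H → ℝ} {φ' A Θ' : H → H} {lam γ δ η : ℝ} {ε : ℝ → ℝ}
    (hφconv : ConvexOn ℝ univ φ) (hφgrad : ∀ x, HasGradientAt φ (φ' x) x)
    (hlam : 0 < lam) (hAcoco : ∀ v w : H, lam * ‖A v - A w‖ ^ 2 ≤ ⟪A v - A w, v - w⟫)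
    (hγ : 0 < γ) (hcond : 1 < lam * γ ^ 2)
    (hδ : 0 < δ) (hΘlip : ∀ x y : H, ‖Θ' x - Θ' y‖ ≤ δ * ‖x - y‖)
    (hη : 0 < η) (hΘsm : ∀ x y : H, η * ‖x - y‖ ^ 2 ≤ ⟪Θ' x - Θ' y, x - y⟫)
    (hεcont : ContinuousOn ε (Ici 0)) (hεpos : ∀ t ∈ Ici (0:ℝ), 0 < ε t)
    (hεlim : Tendsto ε atTop (𝓝 0))
    (hεdiv : (∫⁻ t in Ici (0:ℝ), ENNReal.ofReal (ε t)) = ∞)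
    {u u' u'' : ℝ → H}
    (hu : ∀ t ∈ Ici (0:ℝ), HasDerivWithinAt u (u' t) (Ici 0) t)
    (hu' : ∀ t ∈ Ici (0:ℝ), HasDerivWithinAt u' (u'' t) (Ici 0) t)
    (heq : ∀ t ∈ Ici (0:ℝ), u'' t + γ • u' t + φ' (u t) + A (u t) + ε t • Θ' (u t) = 0)
    {p : H} (hp : φ' p + A p = 0) :
    (∃ R, ∀ᶠ t in atTop, ‖u t‖ ≤ R) ∧
      ((∀ τ > 0, ∀ᶠ t in atTop, -τ ≤ ⟪Θ' p, u t - p⟫) → Tendsto u atTop (𝓝 p)) := by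
  obtain ⟨κ, hκ, K, e₀, he₀, hdiss⟩ :=
    exists_energy_dissipation_rate hlam hγ hcond hδ hη (Θ' p)
  set α := 2 * lam * γ with hα
  have hαpos : 0 < α := by positivity
  set G : ℝ → ℝ := fun t => φ (u t) - φ p - ⟪φ' p, u t - p⟫
  set F : ℝ → ℝ := fun t => α * (1 / 2 * ‖u' t‖ ^ 2 + G t) + ⟪u' t, u t - p⟫
    + γ / 2 * ‖u t - p‖ ^ 2
  set m := (γ - 1 / α) / 2
  have hm : 0 < m := by
    have : 1 / α < γ := by
      rw [div_lt_iff₀ hαpos, hα]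
      linarith
    exact half_pos (sub_pos.mpr this)
  have hG0 : ∀ t, 0 ≤ G t := fun t =>
    sub_nonneg.mpr (hφconv.inner_gradient_le_sub (hφgrad p) (u t))
  have hG1 : ∀ t, G t ≤ ⟪φ' (u t) - φ' p, u t - p⟫ := fun t => by
    have h := hφconv.inner_gradient_le_sub (hφgrad (u t)) p
    rw [← neg_sub (u t) p, inner_neg_right] at h
    rw [inner_sub_left]
    simp only [G]
    linarith
  have hlow : ∀ t, m * ‖u t - p‖ ^ 2 ≤ F t := fun t =>
    energy_lower_bound hαpos (hG0 t) (u' t) (u t - p)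
  have hF := fun t (ht : t ∈ Ici (0 : ℝ)) =>
    hasDerivWithinAt_energy hφgrad α γ p (hu t ht) (hu' t ht)
  have hbound : ∀ τ : ℝ,
      (∀ᶠ t in atTop, K * ε t - ⟪Θ' p, u t - p⟫ - η / 4 * ‖u t - p‖ ^ 2 ≤ τ) →
      ∀ σ > τ / κ, ∀ᶠ t in atTop, F t ≤ σ := by
    intro τ hτ
    obtain ⟨T, hT⟩ := eventually_atTop.mp
      ((hτ.and (hεlim.eventually_le_const he₀)).and (eventually_ge_atTop 0))
    refine gronwall_of_divergent_rate (hT T le_rfl).2 hκ hεcont hεpos hεdiv hF fun t ht => ?_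
    obtain ⟨⟨h1, h2⟩, h3⟩ := hT t ht
    refine (hdiss (u t - p) (u' t) (u'' t) (φ' (u t) - φ' p) (A (u t) - A p) (Θ' (u t)) (G t)
      (ε t) (hG0 t) (hG1 t) (hAcoco _ _) (hΘlip _ _) (hΘsm _ _) (hεpos t h3) h2 ?_).trans
      (mul_le_mul_of_nonneg_right h1 (hεpos t h3).le)
    rw [← heq t h3, ← sub_zero (u'' t + γ • u' t + φ' (u t) + A (u t) + ε t • Θ' (u t)), ← hp]
    abel
  have hKε : ∀ τ > 0, ∀ᶠ t in atTop, K * ε t ≤ τ := fun τ hτ => by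
    have : Tendsto (fun t => K * ε t) atTop (𝓝 0) := by simpa using hεlim.const_mul K
    exact this.eventually_le_const hτ
  constructor
  · set M := (1 + ‖Θ' p‖ ^ 2 / η) / κ + 1 with hM
    refine ⟨√(M / m) + ‖p‖, ?_⟩
    refine (hbound (1 + ‖Θ' p‖ ^ 2 / η) ?_ M (by linarith)).mono fun t ht => ?_
    · filter_upwards [hKε 1 one_pos] with t ht
      have h1 : -(‖Θ' p‖ * ‖u t - p‖) ≤ ⟪Θ' p, u t - p⟫ :=
        neg_le_of_abs_le (abs_real_inner_le_norm _ _)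
      have h2 : 0 ≤ (2 * ‖Θ' p‖ - η * ‖u t - p‖) ^ 2 / (4 * η) := by positivity
      have h3 : (2 * ‖Θ' p‖ - η * ‖u t - p‖) ^ 2 / (4 * η)
          = ‖Θ' p‖ ^ 2 / η - ‖Θ' p‖ * ‖u t - p‖ + η / 4 * ‖u t - p‖ ^ 2 := by
        field_simp
        ring
      linarith
    · have h1 : ‖u t - p‖ ≤ √(M / m) := by
        refine Real.le_sqrt_of_sq_le ?_
        rw [le_div_iff₀ hm]
        linarith [hlow t]
      linarith [norm_le_norm_sub_add (u t) p]
  · intro hw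
    rw [Metric.tendsto_nhds]
    intro r hr
    have hr2 : 0 < κ * (m * r ^ 2) / 4 := by positivity
    refine (hbound (κ * (m * r ^ 2) / 2) ?_ (m * r ^ 2 * (3 / 4)) ?_).mono fun t ht => ?_
    · filter_upwards [hw _ hr2, hKε _ hr2] with t h1 h2
      have : 0 ≤ η / 4 * ‖u t - p‖ ^ 2 := by positivity
      linarith
    · rw [gt_iff_lt, div_lt_iff₀ hκ]
      have : 0 < κ * (m * r ^ 2) := by positivity
      linarith
    · rw [dist_eq_norm]
      have h1 : m * ‖u t - p‖ ^ 2 < m * r ^ 2 := by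
        have : 0 < m * r ^ 2 := by positivity
        linarith [hlow t]
      exact lt_of_pow_lt_pow_left₀ 2 hr.le (lt_of_mul_lt_mul_left h1 hm.le)

/-- For the Tikhonov-regularized dynamic
`ü + γu̇ + ∇φ(u) + A(u) + ε(t)∇Θ(u) = 0` with `λγ² > 1`, `ε` decreasing to `0` and
`∫₀^∞ ε = ∞`, the following are equivalent: (i1) every weak cluster point of `u(t)` belongs to
`S`; (i2) `liminf_{t→∞} ⟪∇Θ(u_*), u(t) − u_*⟫ ≥ 0`; (i3) `u(t) → u_*` strongly, where `u_*` is
the unique solution of the variational inequality `u_* ∈ S`, `⟪∇Θ(u_*), v − u_*⟫ ≥ 0 ∀ v ∈ S`. -/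
theorem tikhonov_dynamic_equivalences
    {H : Type*} [NormedAddCommGroup H] [InnerProductSpace ℝ H] [CompleteSpace H]
    (φ : H → ℝ) (φ' : H → H) (A : H → H) (lam γ : ℝ)
    (Θ : H → ℝ) (Θ' : H → H) (δ η : ℝ) (ε : ℝ → ℝ)
    (hφconv : ConvexOn ℝ univ φ)
    (hφgrad : ∀ x, HasGradientAt φ (φ' x) x)
    (hφlip : ∀ s : Set H, IsBounded s → ∃ K : ℝ≥0, LipschitzOnWith K φ' s)
    (hAmono : ∀ v w : H, 0 ≤ ⟪A v - A w, v - w⟫)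
    (hAmax : ∀ x y : H, (∀ v : H, 0 ≤ ⟪A v - y, v - x⟫) → y = A x)
    (hlam : 0 < lam)
    (hAcoco : ∀ v w : H, lam * ‖A v - A w‖ ^ 2 ≤ ⟪A v - A w, v - w⟫)
    (hγ : 0 < γ) (hcond : 1 < lam * γ ^ 2)
    (hΘconv : ConvexOn ℝ univ Θ) (hΘbdd : BddBelow (range Θ))
    (hΘgrad : ∀ x, HasGradientAt Θ (Θ' x) x)
    (hδ : 0 < δ) (hΘlip : ∀ x y : H, ‖Θ' x - Θ' y‖ ≤ δ * ‖x - y‖)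
    (hη : 0 < η) (hΘsm : ∀ x y : H, η * ‖x - y‖ ^ 2 ≤ ⟪Θ' x - Θ' y, x - y⟫)
    (hεC1 : ContDiffOn ℝ 1 ε (Ici 0)) (hεpos : ∀ t ∈ Ici (0:ℝ), 0 < ε t)
    (hεdec : AntitoneOn ε (Ici 0)) (hεlim : Tendsto ε atTop (𝓝 0))
    (S : Set H) (hS : S = {v : H | φ' v + A v = 0}) (hSne : S.Nonempty)
    (u u' u'' : ℝ → H)
    (hu : ∀ t ∈ Ici (0:ℝ), HasDerivWithinAt u (u' t) (Ici 0) t)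
    (hu' : ∀ t ∈ Ici (0:ℝ), HasDerivWithinAt u' (u'' t) (Ici 0) t)
    (hu''cont : ContinuousOn u'' (Ici 0))
    (heq : ∀ t ∈ Ici (0:ℝ), u'' t + γ • u' t + φ' (u t) + A (u t) + ε t • Θ' (u t) = 0)
    (hεdiv : (∫⁻ t in Ici (0:ℝ), ENNReal.ofReal (ε t)) = ∞)
    (ustar : H) (hustarS : ustar ∈ S) (hustarVI : ∀ v ∈ S, 0 ≤ ⟪Θ' ustar, v - ustar⟫) :
    ((∀ x : H, (∃ tseq : ℕ → ℝ, (∀ n, 0 ≤ tseq n) ∧ Tendsto tseq atTop atTop ∧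
        ∀ f : H →L[ℝ] ℝ, Tendsto (fun n => f (u (tseq n))) atTop (𝓝 (f x))) → x ∈ S)
      ↔ 0 ≤ liminf (fun t => ⟪Θ' ustar, u t - ustar⟫) atTop) ∧
    ((0 ≤ liminf (fun t => ⟪Θ' ustar, u t - ustar⟫) atTop)
      ↔ Tendsto u atTop (𝓝 ustar)) := by
  have hεcont : ContinuousOn ε (Ici 0) := hεC1.continuousOn
  have hp : φ' ustar + A ustar = 0 := by
    rw [hS] at hustarS
    exact hustarS
  obtain ⟨⟨R, hR⟩, hconv⟩ := tikhonov_bounded_and_tendsto hφconv hφgrad hlam hAcoco hγ hcond hδ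
    hΘlip hη hΘsm hεcont hεpos hεlim hεdiv hu hu' heq hp
  set w : ℝ → ℝ := fun t => ⟪Θ' ustar, u t - ustar⟫ with hw
  have hwabs : ∀ᶠ t in atTop, |w t| ≤ ‖Θ' ustar‖ * (R + ‖ustar‖) := by
    filter_upwards [hR] with t ht
    refine (abs_real_inner_le_norm _ _).trans ?_
    gcongr
    exact (norm_sub_le _ _).trans (by gcongr)
  have hwbdd : IsBoundedUnder (· ≥ ·) atTop w :=
    isBoundedUnder_of_eventually_ge (hwabs.mono fun t ht => neg_le_of_abs_le ht)
  have htendsto_of_liminf : 0 ≤ liminf w atTop → Tendsto u atTop (𝓝 ustar) := fun h =>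
    hconv fun τ hτ => (eventually_lt_of_lt_liminf
      (lt_of_lt_of_le (neg_lt_zero.mpr hτ) h) hwbdd).mono fun t ht => ht.le
  have hliminf_of_tendsto : Tendsto u atTop (𝓝 ustar) → 0 ≤ liminf w atTop := fun h => by
    have hlim : Tendsto w atTop (𝓝 0) := by
      simpa using (tendsto_const_nhds (x := Θ' ustar)).inner (𝕜 := ℝ) (h.sub_const ustar)
    exact hlim.liminf_eq.ge
  refine ⟨⟨fun hclust => ?_, fun h x hx => ?_⟩, htendsto_of_liminf, hliminf_of_tendsto⟩
  · refine hliminf_of_tendsto (hconv fun τ hτ => ?_)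
    by_contra hneg
    have hfreq := ((not_eventually.mp hneg).and_eventually hR).and_eventually
      (eventually_ge_atTop (0 : ℝ))
    obtain ⟨s, hs, hsp⟩ := exists_seq_forall_of_frequently hfreq
    obtain ⟨z, k, hk, hz⟩ := exists_subseq_weakly_tendsto (x := fun n => u (s n))
      fun n => (hsp n).1.2
    have hzS : z ∈ S :=
      hclust z ⟨s ∘ k, fun n => (hsp (k n)).2, hs.comp hk.tendsto_atTop, hz⟩
    have hlim : Tendsto (fun n => w (s (k n))) atTop (𝓝 ⟪Θ' ustar, z - ustar⟫) := by
      simpa [hw, inner_sub_right] using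
        (hz (innerSL ℝ (Θ' ustar))).sub_const ⟪Θ' ustar, ustar⟫
    have hle : ⟪Θ' ustar, z - ustar⟫ ≤ -τ :=
      le_of_tendsto' hlim fun n => (not_le.mp (hsp (k n)).1.1).le
    linarith [hustarVI z hzS]
  · obtain ⟨s, -, hs, hsf⟩ := hx
    have hux : Tendsto (fun n => u (s n)) atTop (𝓝 ustar) := (htendsto_of_liminf h).comp hs
    have hinner : ⟪x - ustar, x⟫ = ⟪x - ustar, ustar⟫ :=
      tendsto_nhds_unique (hsf (innerSL ℝ (x - ustar)))
        (((innerSL ℝ (x - ustar)).continuous.tendsto ustar).comp hux)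
    have hxu : x - ustar = 0 := by
      rw [← inner_self_eq_zero (𝕜 := ℝ), inner_sub_right, hinner, sub_self]
    rwa [sub_eq_zero.mp hxu]
end

section
/- Let H be a real Hilbert space, C ⊆ H a nonempty closed convex set, and g : H → ℝ a convex continuously differentiable function whose gradient ∇g is Lipschitz continuous on H with constant L > 0. Let 0 < μ ≤ 2/L. Then the operator A : H → H defined by A(v) := v − P_C(v − μ∇g(v)), where P_C is the metric projection onto C, is (1/2)-cocoercive: ⟨Au − Av, u − v⟩ ≥ (1/2)|Au − Av|² for all u, v ∈ H. -/
open Set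
open scoped RealInnerProductSpace

/-- The derivative of a function with a gradient along an affine line. -/
theorem HasGradientAt.hasDerivAt_comp_line {H : Type*} [NormedAddCommGroup H]
    [InnerProductSpace ℝ H] [CompleteSpace H] {g : H → ℝ} {x d w : H} {t : ℝ}
    (h : HasGradientAt g w (x + t • d)) :
    HasDerivAt (fun s : ℝ => g (x + s • d)) ⟪w, d⟫ t := by
  have hline : HasDerivAt (fun s : ℝ => x + s • d) d t := by
    simpa using ((hasDerivAt_id t).smul_const d).const_add x
  simpa [Function.comp_def] using h.hasFDerivAt.comp_hasDerivAt t hline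

/-- A convex function lies above its tangent hyperplanes. -/
theorem ConvexOn.add_inner_le_of_hasGradientAt {H : Type*} [NormedAddCommGroup H]
    [InnerProductSpace ℝ H] [CompleteSpace H] {g : H → ℝ} {x w : H}
    (hg : ConvexOn ℝ univ g) (h : HasGradientAt g w x) (y : H) :
    g x + ⟪w, y - x⟫ ≤ g y := by
  have hconv : ConvexOn ℝ univ (fun s : ℝ => g (x + s • (y - x))) := by
    have := hg.comp_affineMap (AffineMap.lineMap x y : ℝ →ᵃ[ℝ] H)
    simpa [Function.comp_def, AffineMap.lineMap_apply, add_comm] using this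
  have hderiv : HasDerivAt (fun s : ℝ => g (x + s • (y - x))) ⟪w, y - x⟫ 0 :=
    HasGradientAt.hasDerivAt_comp_line (by simpa using h)
  have := hconv.le_slope_of_hasDerivAt (mem_univ 0) (mem_univ 1) one_pos hderiv
  simp [slope_def_field] at this
  linarith

/-- The descent lemma: a function with `L`-Lipschitz gradient lies below its tangent
paraboloids of curvature `L`. -/
theorem le_add_inner_add_of_lipschitz_gradient {H : Type*} [NormedAddCommGroup H]
    [InnerProductSpace ℝ H] [CompleteSpace H] {g : H → ℝ} {g' : H → H} {L : ℝ}
    (hggrad : ∀ x, HasGradientAt g (g' x) x)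
    (hglip : ∀ x y : H, ‖g' x - g' y‖ ≤ L * ‖x - y‖) (x y : H) :
    g y ≤ g x + ⟪g' x, y - x⟫ + L / 2 * ‖y - x‖ ^ 2 := by
  set d := y - x with hd
  have hderiv (t : ℝ) : HasDerivAt
      (fun s : ℝ => g (x + s • d) - (s * ⟪g' x, d⟫ + s ^ 2 * (L / 2 * ‖d‖ ^ 2)))
      (⟪g' (x + t • d), d⟫ - (⟪g' x, d⟫ + 2 * t * (L / 2 * ‖d‖ ^ 2))) t := by
    refine (HasGradientAt.hasDerivAt_comp_line (hggrad _)).sub (HasDerivAt.add ?_ ?_)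
    · simpa using (hasDerivAt_id t).mul_const ⟪g' x, d⟫
    · simpa using (hasDerivAt_pow 2 t).mul_const (L / 2 * ‖d‖ ^ 2)
  have hanti : AntitoneOn
      (fun s : ℝ => g (x + s • d) - (s * ⟪g' x, d⟫ + s ^ 2 * (L / 2 * ‖d‖ ^ 2)))
      (Icc 0 1) := by
    refine antitoneOn_of_deriv_nonpos (convex_Icc 0 1)
      (fun t _ => (hderiv t).continuousAt.continuousWithinAt)
      (fun t _ => (hderiv t).differentiableAt.differentiableWithinAt) fun t ht => ?_
    rw [interior_Icc] at ht
    rw [(hderiv t).deriv]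
    have hlip : ‖g' (x + t • d) - g' x‖ ≤ L * (t * ‖d‖) := by
      simpa [norm_smul, abs_of_pos ht.1] using hglip (x + t • d) x
    have hinner := real_inner_le_norm (g' (x + t • d) - g' x) d
    rw [inner_sub_left] at hinner
    have := mul_le_mul_of_nonneg_right hlip (norm_nonneg d)
    linarith
  have := hanti (left_mem_Icc.2 zero_le_one) (right_mem_Icc.2 zero_le_one) zero_le_one
  have hxd : x + d = y := by simp [hd]
  simp [hxd] at this
  linarith

/-- **Baillon–Haddad theorem**: the gradient of a convex function, if `L`-Lipschitz, is
`1 / L`-cocoercive. -/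
theorem ConvexOn.norm_gradient_sub_sq_le_of_lipschitz {H : Type*} [NormedAddCommGroup H]
    [InnerProductSpace ℝ H] [CompleteSpace H] {g : H → ℝ} {g' : H → H} {L : ℝ}
    (hg : ConvexOn ℝ univ g) (hggrad : ∀ x, HasGradientAt g (g' x) x) (hL : 0 < L)
    (hglip : ∀ x y : H, ‖g' x - g' y‖ ≤ L * ‖x - y‖) (x y : H) :
    1 / L * ‖g' x - g' y‖ ^ 2 ≤ ⟪g' x - g' y, x - y⟫ := by
  have key (a b : H) :
      g a + ⟪g' a, b - a⟫ + 1 / (2 * L) * ‖g' b - g' a‖ ^ 2 ≤ g b := by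
    set D := g' b - g' a with hD
    have hlower := hg.add_inner_le_of_hasGradientAt (hggrad a) (b - L⁻¹ • D)
    have hupper := le_add_inner_add_of_lipschitz_gradient hggrad hglip b (b - L⁻¹ • D)
    have hsq : ⟪g' b, D⟫ - ⟪g' a, D⟫ = ‖D‖ ^ 2 := by
      rw [← inner_sub_left, ← hD, real_inner_self_eq_norm_sq]
    rw [sub_right_comm, inner_sub_right, real_inner_smul_right] at hlower
    rw [sub_sub_cancel_left, inner_neg_right, real_inner_smul_right, norm_neg, norm_smul,
      Real.norm_of_nonneg (inv_nonneg.2 hL.le)] at hupper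
    have hcoef : L / 2 * (L⁻¹ * ‖D‖) ^ 2 = L⁻¹ * ‖D‖ ^ 2 - 1 / (2 * L) * ‖D‖ ^ 2 := by
      field_simp
      ring
    have hmul : L⁻¹ * ⟪g' b, D⟫ - L⁻¹ * ⟪g' a, D⟫ = L⁻¹ * ‖D‖ ^ 2 := by
      rw [← mul_sub, hsq]
    linarith
  have hxy := key x y
  have hyx := key y x
  rw [norm_sub_rev, ← neg_sub x y, inner_neg_right] at hxy
  rw [inner_sub_left]
  have : 1 / L * ‖g' x - g' y‖ ^ 2 = 2 * (1 / (2 * L) * ‖g' x - g' y‖ ^ 2) := by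
    field_simp
  linarith

/-- A map satisfying the variational inequality of the metric projection onto `C` is
nonexpansive. -/
theorem norm_sub_le_of_projection_inner_nonpos {H : Type*} [NormedAddCommGroup H]
    [InnerProductSpace ℝ H] {C : Set H} {P : H → H}
    (hP : ∀ v : H, P v ∈ C ∧ ∀ w ∈ C, ⟪v - P v, w - P v⟫ ≤ 0) (a b : H) :
    ‖P a - P b‖ ≤ ‖a - b‖ := by
  have ha := (hP a).2 _ (hP b).1
  have hb := (hP b).2 _ (hP a).1
  have hfirm : ‖P a - P b‖ ^ 2 ≤ ⟪a - b, P a - P b⟫ := by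
    rw [← real_inner_self_eq_norm_sq]
    simp only [inner_sub_left, inner_sub_right] at *
    linarith
  have := real_inner_le_norm (a - b) (P a - P b)
  nlinarith [norm_nonneg (P a - P b), norm_nonneg (a - b)]

/-- For a nonempty closed convex `C ⊆ H` and a convex `C¹` function `g` with
`L`-Lipschitz gradient, and `0 < μ ≤ 2/L`, the gradient-projection operator
`A(v) := v − P_C(v − μ∇g(v))` is `(1/2)`-cocoercive.  The projection `P_C` is characterized by
the variational inequality `P_C v ∈ C` and `⟪v − P_C v, w − P_C v⟫ ≤ 0` for all `w ∈ C`. -/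
theorem gradient_projection_operator_cocoercive
    {H : Type*} [NormedAddCommGroup H] [InnerProductSpace ℝ H] [CompleteSpace H]
    (C : Set H) (hCne : C.Nonempty) (hCclosed : IsClosed C) (hCconv : Convex ℝ C)
    (g : H → ℝ) (g' : H → H) (L μ : ℝ)
    (hgconv : ConvexOn ℝ univ g)
    (hggrad : ∀ x, HasGradientAt g (g' x) x)
    (hg'cont : Continuous g')
    (hL : 0 < L) (hglip : ∀ x y : H, ‖g' x - g' y‖ ≤ L * ‖x - y‖)
    (hμ : 0 < μ) (hμL : μ ≤ 2 / L)
    (P : H → H)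
    (hP : ∀ v : H, P v ∈ C ∧ ∀ w ∈ C, ⟪v - P v, w - P v⟫ ≤ 0)
    (u v : H) :
    (1 / 2) * ‖(u - P (u - μ • g' u)) - (v - P (v - μ • g' v))‖ ^ 2 ≤
      ⟪(u - P (u - μ • g' u)) - (v - P (v - μ • g' v)), u - v⟫ := by
  have hbh := hgconv.norm_gradient_sub_sq_le_of_lipschitz hggrad hL hglip u v
  have hproj := norm_sub_le_of_projection_inner_nonpos hP (u - μ • g' u) (v - μ • g' v)
  set p := P (u - μ • g' u) - P (v - μ • g' v) with hp
  set D := g' u - g' v with hD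
  set d := u - v with hd
  have harg : u - μ • g' u - (v - μ • g' v) = d - μ • D := by
    rw [hd, hD, smul_sub]
    abel
  have hA : u - P (u - μ • g' u) - (v - P (v - μ • g' v)) = d - p := by
    rw [hd, hp]
    abel
  rw [harg] at hproj
  have hstep : ‖d - μ • D‖ ^ 2 ≤ ‖d‖ ^ 2 := by
    rw [norm_sub_sq_real, real_inner_smul_right, norm_smul, Real.norm_of_nonneg hμ.le,
      real_inner_comm]
    have hμD : μ * ‖D‖ ^ 2 ≤ 2 * ⟪D, d⟫ :=
      calc μ * ‖D‖ ^ 2 ≤ 2 / L * ‖D‖ ^ 2 := by gcongr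
        _ = 2 * (1 / L * ‖D‖ ^ 2) := by ring
        _ ≤ 2 * ⟪D, d⟫ := by gcongr
    nlinarith
  have hpd : ‖p‖ ^ 2 ≤ ‖d‖ ^ 2 := (pow_le_pow_left₀ (norm_nonneg p) hproj 2).trans hstep
  rw [hA, norm_sub_sq_real, inner_sub_left d p, real_inner_self_eq_norm_sq, real_inner_comm d p]
  linarith
end
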